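/- In (𝒟 ⊗_𝕂 𝒟)⟦t⟧ the quasi R-matrix of U_q(sl_2) factors into four quantum dilogarithms: Ψ_t((w_1 + w_2) ⊗ (w_3 + w_4)) = Ψ_t(w_1 ⊗ w_3) · Ψ_t(w_1 ⊗ w_4) · Ψ_t(w_2 ⊗ w_3) · Ψ_t(w_2 ⊗ w_4). (Here the left-hand side is Ψ^q(−t·E⊗F) for E = 𝐢(w_1+w_2), F = 𝐢(w_3+w_4), i.e. the quasi R-matrix R̄ = Ψ^q(−E⊗F) of U_q(sl_2) under Faddeev's embedding, with a central variable t inserted.) -/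

import Mathlib

noncomputable section

open scoped TensorProduct

/-- The ground field `𝕂 = ℂ(q)`, the field of rational functions over `ℂ`. -/
abbrev Kq : Type := RatFunc ℂ

/-- The formal variable `q ∈ ℂ(q)`. -/
def qq : Kq := RatFunc.X

/-- The defining relations of the quantum torus `𝒟`: generators `w_i^{±1}` (`i ∈ ℤ/4`,
`Sum.inl i` is `w_{i+1}`, `Sum.inr i` is `w_{i+1}⁻¹`) with `w_i w_{i+1} = q^{−2} w_{i+1} w_i`
(indices modulo 4) and `w_i w_{i+2} = w_{i+2} w_i`. -/
inductive WRel : FreeAlgebra Kq (Fin 4 ⊕ Fin 4) → FreeAlgebra Kq (Fin 4 ⊕ Fin 4) → Prop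
  | cyc (i : Fin 4) :
      WRel (FreeAlgebra.ι Kq (Sum.inl i) * FreeAlgebra.ι Kq (Sum.inl (i + 1)))
        ((qq ^ (-2 : ℤ)) • (FreeAlgebra.ι Kq (Sum.inl (i + 1)) * FreeAlgebra.ι Kq (Sum.inl i)))
  | opp (i : Fin 4) :
      WRel (FreeAlgebra.ι Kq (Sum.inl i) * FreeAlgebra.ι Kq (Sum.inl (i + 2)))
        (FreeAlgebra.ι Kq (Sum.inl (i + 2)) * FreeAlgebra.ι Kq (Sum.inl i))
  | mul_inv (i : Fin 4) :
      WRel (FreeAlgebra.ι Kq (Sum.inl i) * FreeAlgebra.ι Kq (Sum.inr i)) 1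
  | inv_mul (i : Fin 4) :
      WRel (FreeAlgebra.ι Kq (Sum.inr i) * FreeAlgebra.ι Kq (Sum.inl i)) 1

/-- The quantum torus `𝒟` with generators `w₁^{±1}, …, w₄^{±1}`. -/
abbrev Wtorus := RingQuot WRel

/-- The generator `w_{i+1}` of `𝒟` (so `wg 0 = w₁`, …, `wg 3 = w₄`). -/
def wg (i : Fin 4) : Wtorus := RingQuot.mkAlgHom Kq WRel (FreeAlgebra.ι Kq (Sum.inl i))

/-- `𝒟 ⊗_𝕂 𝒟`. -/
abbrev WW := Wtorus ⊗[Kq] Wtorus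

/-- `∏_{j=1}^{m} (q^{2j} − 1)`. -/
def qfac (m : ℕ) : Kq := ∏ j ∈ Finset.range m, (qq ^ (2 * (j + 1)) - 1)

/-- The quantum dilogarithm `Ψ_t(x) = Ψ^q(tx) ∈ (𝒟 ⊗ 𝒟)⟦t⟧`, i.e. the t-adically
convergent infinite product `∏_{k=0}^{∞} (1 + q^{2k+1} t x)^{−1}`; explicitly it is the
`q`-exponential series `Σ_{m≥0} q^m x^m t^m / ∏_{j=1}^{m}(q^{2j} − 1)`, the unique
solution with constant term `1` of `Ψ^q(q²z) = (1+qz)Ψ^q(z)` at `z = tx`. -/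
def PsiT (x : WW) : PowerSeries WW :=
  PowerSeries.mk fun d => ((qq ^ d / qfac d) • x ^ d)

lemma qq_pow_sub_one_ne_zero (n : ℕ) : qq ^ (2 * (n + 1)) - 1 ≠ 0 := by
  intro h
  have h1 : (algebraMap (Polynomial ℂ) Kq) (Polynomial.X ^ (2 * (n + 1))) =
      algebraMap (Polynomial ℂ) Kq 1 := by
    rw [map_pow, RatFunc.algebraMap_X, map_one]
    exact sub_eq_zero.mp h
  have h2 := congrArg Polynomial.natDegree (RatFunc.algebraMap_injective ℂ h1)
  simp at h2

lemma qq_ne_zero : qq ≠ 0 := RatFunc.X_ne_zero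

/-- The coefficient `q^m / ∏_{j=1}^m (q^{2j} − 1)` of the quantum dilogarithm. -/
def dilogCoeff (m : ℕ) : Kq := qq ^ m / qfac m

lemma dilogCoeff_succ (m : ℕ) :
    (qq ^ (2 * (m + 1)) - 1) * dilogCoeff (m + 1) = qq * dilogCoeff m := by
  have h := qq_pow_sub_one_ne_zero m
  have hf : qfac m ≠ 0 := Finset.prod_ne_zero_iff.mpr fun j _ => qq_pow_sub_one_ne_zero j
  have hs : qfac (m + 1) = qfac m * (qq ^ (2 * (m + 1)) - 1) := Finset.prod_range_succ _ _
  rw [dilogCoeff, dilogCoeff, hs]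
  field_simp
  ring

lemma mul_pow_of_qcomm {A : Type*} [Ring A] [Algebra Kq A] {x y : A}
    (h : y * x = qq ^ 2 • (x * y)) (n : ℕ) :
    y * x ^ n = qq ^ (2 * n) • (x ^ n * y) := by
  induction n with
  | zero => simp
  | succ n ih =>
    rw [pow_succ, ← mul_assoc, ih, smul_mul_assoc, mul_assoc, h, mul_smul_comm, smul_smul,
      ← mul_assoc, ← pow_add, mul_add, mul_one]

/-- The `q`-binomial theorem, in the normalization of the quantum dilogarithm. -/
lemma dilogCoeff_smul_add_pow {A : Type*} [Ring A] [Algebra Kq A] {x y : A}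
    (h : y * x = qq ^ 2 • (x * y)) (n : ℕ) :
    dilogCoeff n • (x + y) ^ n = ∑ p ∈ Finset.HasAntidiagonal.antidiagonal n,
      (dilogCoeff p.1 • x ^ p.1) * (dilogCoeff p.2 • y ^ p.2) := by
  induction n with
  | zero => simp [dilogCoeff, qfac]
  | succ n ih =>
    have hx : qq • (x * ∑ p ∈ Finset.HasAntidiagonal.antidiagonal n,
          (dilogCoeff p.1 • x ^ p.1) * (dilogCoeff p.2 • y ^ p.2)) =
        ∑ p ∈ Finset.HasAntidiagonal.antidiagonal (n + 1), (qq ^ (2 * p.1) - 1) •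
          ((dilogCoeff p.1 • x ^ p.1) * (dilogCoeff p.2 • y ^ p.2)) := by
      rw [Finset.Nat.sum_antidiagonal_succ, Finset.mul_sum, Finset.smul_sum]
      simp only [mul_zero, pow_zero, sub_self, zero_smul, zero_add]
      refine Finset.sum_congr rfl fun p _ => ?_
      rw [← smul_mul_assoc (_ - _), smul_smul, dilogCoeff_succ, pow_succ']
      simp only [smul_mul_assoc, mul_smul_comm, smul_smul, mul_assoc]
      congr 1
      ring
    have hy : qq • (y * ∑ p ∈ Finset.HasAntidiagonal.antidiagonal n,
          (dilogCoeff p.1 • x ^ p.1) * (dilogCoeff p.2 • y ^ p.2)) =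
        ∑ p ∈ Finset.HasAntidiagonal.antidiagonal (n + 1), (qq ^ (2 * p.1) * (qq ^ (2 * p.2) - 1)) •
          ((dilogCoeff p.1 • x ^ p.1) * (dilogCoeff p.2 • y ^ p.2)) := by
      rw [Finset.Nat.sum_antidiagonal_succ', Finset.mul_sum, Finset.smul_sum]
      simp only [mul_zero, pow_zero, sub_self, zero_smul, zero_add]
      refine Finset.sum_congr rfl fun p _ => ?_
      rw [mul_smul, ← mul_smul_comm (_ - _), smul_smul (_ - _), dilogCoeff_succ, pow_succ',
        ← mul_assoc, mul_smul_comm, mul_smul_comm, mul_pow_of_qcomm h]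
      simp only [smul_mul_assoc, mul_smul_comm, smul_smul, mul_assoc]
      congr 1
      ring
    refine smul_right_injective A (qq_pow_sub_one_ne_zero n) ?_
    simp only
    rw [smul_smul, dilogCoeff_succ, pow_succ', mul_smul, ← mul_smul_comm, ih, add_mul, smul_add,
      hx, hy, ← Finset.sum_add_distrib, Finset.smul_sum]
    refine Finset.sum_congr rfl fun p hp => ?_
    rw [← add_smul, ← Finset.HasAntidiagonal.mem_antidiagonal.mp hp]
    congr 1
    ring

lemma PsiT_add {x y : WW} (h : y * x = qq ^ 2 • (x * y)) :
    PsiT (x + y) = PsiT x * PsiT y := by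
  ext n
  simp only [PsiT, PowerSeries.coeff_mul, PowerSeries.coeff_mk]
  exact dilogCoeff_smul_add_pow (A := WW) h n

lemma wg_succ_mul (i : Fin 4) : wg (i + 1) * wg i = qq ^ 2 • (wg i * wg (i + 1)) := by
  have h := RingQuot.mkAlgHom_rel Kq (WRel.cyc i)
  rw [map_smul, map_mul, map_mul] at h
  change wg i * wg (i + 1) = qq ^ (-2 : ℤ) • (wg (i + 1) * wg i) at h
  have hq : qq ^ 2 * qq ^ (-2 : ℤ) = 1 := by
    rw [zpow_neg]
    exact mul_inv_cancel₀ (pow_ne_zero 2 qq_ne_zero)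
  rw [h, smul_smul, hq, one_smul]

lemma PsiT_add_tmul {u v : Wtorus} (h : v * u = qq ^ 2 • (u * v)) (f : Wtorus) :
    PsiT ((u + v) ⊗ₜ[Kq] f) = PsiT (u ⊗ₜ[Kq] f) * PsiT (v ⊗ₜ[Kq] f) := by
  rw [TensorProduct.add_tmul]
  apply PsiT_add
  rw [Algebra.TensorProduct.tmul_mul_tmul, Algebra.TensorProduct.tmul_mul_tmul, h,
    TensorProduct.smul_tmul']

lemma PsiT_tmul_add {u v : Wtorus} (h : v * u = qq ^ 2 • (u * v)) (e : Wtorus) :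
    PsiT (e ⊗ₜ[Kq] (u + v)) = PsiT (e ⊗ₜ[Kq] u) * PsiT (e ⊗ₜ[Kq] v) := by
  rw [TensorProduct.tmul_add]
  apply PsiT_add
  rw [Algebra.TensorProduct.tmul_mul_tmul, Algebra.TensorProduct.tmul_mul_tmul, h,
    TensorProduct.tmul_smul]

/-- In `(𝒟 ⊗ 𝒟)⟦t⟧` the quasi `R`-matrix of `U_q(sl₂)` factors into
four quantum dilogarithms:
`Ψ_t((w₁+w₂) ⊗ (w₃+w₄)) = Ψ_t(w₁⊗w₃) Ψ_t(w₁⊗w₄) Ψ_t(w₂⊗w₃) Ψ_t(w₂⊗w₄)`. -/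
theorem statement17 :
    PsiT ((wg 0 + wg 1) ⊗ₜ[Kq] (wg 2 + wg 3))
      = PsiT ((wg 0) ⊗ₜ[Kq] (wg 2)) * PsiT ((wg 0) ⊗ₜ[Kq] (wg 3))
        * PsiT ((wg 1) ⊗ₜ[Kq] (wg 2)) * PsiT ((wg 1) ⊗ₜ[Kq] (wg 3)) := by
  have h₀ : wg 1 * wg 0 = qq ^ 2 • (wg 0 * wg 1) := wg_succ_mul 0
  have h₂ : wg 3 * wg 2 = qq ^ 2 • (wg 2 * wg 3) := wg_succ_mul 2
  rw [PsiT_add_tmul h₀, PsiT_tmul_add h₂, PsiT_tmul_add h₂, ← mul_assoc]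

end
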